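/- Fix α ∈ (0,1). For every sufficiently small ε > 0 there exist real numbers a, b with 1 − ε < a < b < 1 such that for every Borel probability measure θ on ℝ that is absolutely continuous with respect to Lebesgue measure and has support contained in [a, b], the Dirac measure δ_0 is a stationary measure for the random system ((f_t)_t, θ), and it is the unique stationary Borel probability measure for this random system. -/

import Mathlib

open MeasureTheory Set Filter Topology

noncomputable section

/-- The circle `S¹ = ℝ/ℤ`. -/
abbrev Circle1 : Type := AddCircle (1 : ℝ)

/-- Lift `F_t` of the map `f_t`: it satisfies `F_t(x+1) = F_t(x) + 2`,
`F_t(x) = t x + 2^α (2-t) x^(1+α)` for `x ∈ [0,1/2)` and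
`F_t(x) = 2 - t(1-x) - 2^α (2-t) (1-x)^(1+α)` for `x ∈ [1/2,1)`. -/
noncomputable def Flift (α t x : ℝ) : ℝ :=
  2 * (⌊x⌋ : ℝ) +
    (if Int.fract x < 1 / 2
      then t * Int.fract x + 2 ^ α * (2 - t) * Int.fract x ^ (1 + α)
      else 2 - t * (1 - Int.fract x) - 2 ^ α * (2 - t) * (1 - Int.fract x) ^ (1 + α))

/-- The circle map `f_t` induced by the lift `F_t`. -/
noncomputable def fmap (α t : ℝ) : Circle1 → Circle1 :=
  AddCircle.liftIco 1 0 (fun x => ((Flift α t x : ℝ) : Circle1))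

/-- The fixed point `p_s = (1/2)·((1−s)/(2−s))^(1/α)` of `f_s`. -/
noncomputable def pfix (α s : ℝ) : ℝ := (1 / 2) * ((1 - s) / (2 - s)) ^ (1 / α)

/-- Random iteration: `fIter α ω 0 = id` and
`fIter α ω (n+1) = f_{ω n} ∘ fIter α ω n`. -/
noncomputable def fIter (α : ℝ) (ω : ℕ → ℝ) : ℕ → Circle1 → Circle1
  | 0 => id
  | n + 1 => fmap α (ω n) ∘ fIter α ω n

/-- The (closed) support of a measure on a topological space. -/
def mSupport {Y : Type*} [TopologicalSpace Y] [MeasurableSpace Y] (θ : Measure Y) : Set Y :=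
  {t | ∀ U ∈ 𝓝 t, θ U ≠ 0}

/-- `μ` is a stationary measure for the random system given by the family `g`
of maps of the circle and the noise distribution `θ`. -/
def IsStationaryC (g : ℝ → Circle1 → Circle1) (θ : Measure ℝ) (μ : Measure Circle1) : Prop :=
  ∀ φ : C(Circle1, ℝ), ∫ x, ∫ t, φ (g t x) ∂θ ∂μ = ∫ x, φ x ∂μ

/-- `P` is the countable product `θ^ℕ` of copies of the probability measure `θ`. -/
def IsProductOf {Y : Type*} [MeasurableSpace Y] (θ : Measure Y) (P : Measure (ℕ → Y)) : Prop :=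
  IsProbabilityMeasure P ∧ ∀ (k : ℕ) (A : ℕ → Set Y), (∀ i, MeasurableSet (A i)) →
    P {ω | ∀ i < k, ω i ∈ A i} = ∏ i ∈ Finset.range k, θ (A i)


/-- The restriction of the lift `F_t` to `[0, 1/2]`. -/
def branch (α t x : ℝ) : ℝ := t * x + 2 ^ α * (2 - t) * x ^ (1 + α)

lemma branch_eq {α t x : ℝ} (hα : 0 < α) (hx : 0 ≤ x) :
    branch α t x = x * (t + (2 - t) * (2 * x) ^ α) := by
  rw [branch, Real.rpow_one_add' hx (by linarith), Real.mul_rpow (by norm_num) hx]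
  ring

lemma branch_zero {α t : ℝ} (hα : 0 < α) : branch α t 0 = 0 := by
  rw [branch_eq hα le_rfl, zero_mul]

lemma branch_half {α t : ℝ} (hα : 0 < α) : branch α t (1 / 2) = 1 := by
  rw [branch_eq hα (by norm_num)]
  norm_num

lemma branch_nonneg {α t x : ℝ} (hα : 0 < α) (ht0 : 0 ≤ t) (ht1 : t ≤ 1) (hx : 0 ≤ x) :
    0 ≤ branch α t x := by
  rw [branch_eq hα hx]
  have : 0 ≤ (2 - t) * (2 * x) ^ α := mul_nonneg (by linarith) (by positivity)
  positivity

lemma branch_le_one {α t x : ℝ} (hα : 0 < α) (ht1 : t ≤ 1) (hx : 0 ≤ x)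
    (hx1 : x ≤ 1 / 2) : branch α t x ≤ 1 := by
  rw [branch_eq hα hx]
  have h1 : (2 * x) ^ α ≤ 1 := Real.rpow_le_one (by linarith) (by linarith) hα.le
  have h2 : t + (2 - t) * (2 * x) ^ α ≤ 2 := by nlinarith
  nlinarith

/-- To the left of the repelling fixed point of `f_b`, every `f_t` with `t ≤ b` moves points
towards `0`. -/
lemma branch_lt_self {α t b p x : ℝ} (hα : 0 < α) (hb : b < 1) (htb : t ≤ b)
    (hp : (2 * p) ^ α = (1 - b) / (2 - b)) (hx : 0 < x) (hxp : x < p) : branch α t x < x := by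
  rw [branch_eq hα hx.le]
  have h1 : (2 * x) ^ α < (1 - b) / (2 - b) :=
    hp ▸ Real.rpow_lt_rpow (by linarith) (by linarith) hα
  have h2 : (1 - b) / (2 - b) ≤ (1 - t) / (2 - t) := by
    rw [div_le_div_iff₀ (by linarith) (by linarith)]
    nlinarith
  have h3 := (lt_div_iff₀ (by linarith)).1 (h1.trans_le h2)
  nlinarith

lemma branch_expanding {α t p q x y : ℝ} (hα : 0 < α) (ht1 : t ≤ 1) (hp0 : 0 < p)
    (hp : (2 * p) ^ α = q) (hx : p ≤ x) (hxy : x ≤ y) :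
    (t + (1 + α) * (2 - t) * q) * (y - x) ≤ branch α t y - branch α t x := by
  have hx0 : 0 < x := hp0.trans_le hx
  have hq : q ≤ 2 ^ α * x ^ α := by
    rw [← hp, ← Real.mul_rpow (by norm_num) hx0.le]
    exact Real.rpow_le_rpow (by linarith) (by linarith) hα.le
  have hB : 1 + (1 + α) * ((y - x) / x) ≤ (1 + (y - x) / x) ^ (1 + α) :=
    one_add_mul_self_le_rpow_one_add
      (by have : 0 ≤ (y - x) / x := div_nonneg (by linarith) hx0.le
          linarith) (by linarith)
  have hyx : 1 + (y - x) / x = y / x := by field_simp; ring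
  rw [hyx, Real.div_rpow (hx0.le.trans hxy) hx0.le, le_div_iff₀ (by positivity)] at hB
  have hpow : x ^ (1 + α) = x * x ^ α := Real.rpow_one_add' hx0.le (by linarith)
  have hB' : x ^ (1 + α) + (1 + α) * x ^ α * (y - x) ≤ y ^ (1 + α) := by
    refine le_trans (le_of_eq ?_) hB
    rw [hpow]
    field_simp
  have h4 : q * (y - x) ≤ 2 ^ α * x ^ α * (y - x) :=
    mul_le_mul_of_nonneg_right hq (by linarith)
  have h5 : (2 : ℝ) ^ α * (x ^ (1 + α) + (1 + α) * x ^ α * (y - x)) ≤ 2 ^ α * y ^ (1 + α) :=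
    mul_le_mul_of_nonneg_left hB' (by positivity)
  have h6 : (1 + α) * (q * (y - x)) ≤ 2 ^ α * y ^ (1 + α) - 2 ^ α * x ^ (1 + α) := by
    have := mul_le_mul_of_nonneg_left h4 (by linarith : 0 ≤ 1 + α)
    linarith
  have h7 := mul_le_mul_of_nonneg_left h6 (by linarith : 0 ≤ 2 - t)
  unfold branch
  linarith

lemma continuous_branch {α t : ℝ} (hα : 0 < α) : Continuous (branch α t) := by
  unfold branch
  have : Continuous fun x : ℝ => x ^ (1 + α) := Real.continuous_rpow_const (by linarith)
  fun_prop

lemma continuous_branch_param {α x : ℝ} : Continuous fun t => branch α t x := by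
  unfold branch
  fun_prop

lemma Flift_eq_branch {α t x : ℝ} (hα : 0 < α) (h0 : 0 ≤ x) (h1 : x ≤ 1 / 2) :
    Flift α t x = branch α t x := by
  have hf : Int.fract x = x := Int.fract_eq_self.2 ⟨h0, by linarith⟩
  have hfl : ⌊x⌋ = 0 := Int.floor_eq_zero_iff.2 ⟨h0, by linarith⟩
  rw [Flift, hf, hfl]
  split_ifs with h
  · simp [branch]
  · obtain rfl : x = 1 / 2 := by linarith
    rw [show (1 : ℝ) - 1 / 2 = 1 / 2 by norm_num]
    have := branch_half (t := t) hα
    rw [this]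
    unfold branch at this
    push_cast
    linarith

lemma Flift_one_sub {α t x : ℝ} (hα : 0 < α) (h0 : 0 ≤ x) (h1 : x ≤ 1 / 2) :
    Flift α t (1 - x) = 2 - branch α t x := by
  rcases h0.eq_or_lt with rfl | h0
  · rw [branch_zero hα]
    have : (0 : ℝ) ^ (1 + α) = 0 := Real.zero_rpow (by linarith)
    simp [Flift, this]
  · have hf : Int.fract (1 - x) = 1 - x := Int.fract_eq_self.2 ⟨by linarith, by linarith⟩
    have hfl : ⌊1 - x⌋ = 0 := Int.floor_eq_zero_iff.2 ⟨by linarith, by linarith⟩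
    rw [Flift, hf, hfl, if_neg (by linarith), sub_sub_cancel, branch]
    push_cast
    ring

lemma coe_two_eq_zero : ((2 : ℝ) : Circle1) = 0 := by
  have h : ((1 : ℝ) : Circle1) = 0 := AddCircle.coe_period 1
  rw [show (2 : ℝ) = 1 + 1 by norm_num, AddCircle.coe_add, h, add_zero]

lemma fmap_coe {α t x : ℝ} (hα : 0 < α) (h0 : 0 ≤ x) (h1 : x ≤ 1 / 2) :
    fmap α t (x : Circle1) = (branch α t x : Circle1) := by
  rw [fmap, AddCircle.liftIco_zero_coe_apply ⟨h0, by linarith⟩, Flift_eq_branch hα h0 h1]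

lemma fmap_zero {α t : ℝ} (hα : 0 < α) : fmap α t 0 = 0 := by
  have := fmap_coe (t := t) hα le_rfl (by norm_num : (0 : ℝ) ≤ 1 / 2)
  rwa [branch_zero hα, AddCircle.coe_zero] at this

lemma fmap_neg_coe {α t x : ℝ} (hα : 0 < α) (h0 : 0 ≤ x) (h1 : x ≤ 1 / 2) :
    fmap α t (-(x : Circle1)) = -(branch α t x : Circle1) := by
  rcases h0.eq_or_lt with rfl | h0
  · rw [branch_zero hα, AddCircle.coe_zero, neg_zero, fmap_zero hα]
  · have h : -(x : Circle1) = ((1 - x : ℝ) : Circle1) := by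
      rw [AddCircle.coe_sub, AddCircle.coe_period, zero_sub]
    rw [h, fmap, AddCircle.liftIco_zero_coe_apply ⟨by linarith, by linarith⟩,
      Flift_one_sub hα h0.le h1, AddCircle.coe_sub, coe_two_eq_zero, zero_sub]

lemma exists_half_rep (z : Circle1) :
    ∃ x : ℝ, 0 ≤ x ∧ x ≤ 1 / 2 ∧ (z = (x : Circle1) ∨ z = -(x : Circle1)) := by
  obtain ⟨x, hx, rfl⟩ : z ∈ ((↑) : ℝ → Circle1) '' Ico 0 (0 + 1) :=
    AddCircle.coe_image_Ico_eq (1 : ℝ) 0 ▸ mem_univ z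
  rcases le_total x (1 / 2) with h | h
  · exact ⟨x, hx.1, h, Or.inl rfl⟩
  · refine ⟨1 - x, by linarith [hx.2], by linarith, Or.inr ?_⟩
    rw [AddCircle.coe_sub, AddCircle.coe_period, zero_sub, neg_neg]

lemma continuous_fmap {α t : ℝ} (hα : 0 < α) : Continuous (fmap α t) := by
  have hc : ContinuousOn (Flift α t) (Icc 0 1) := by
    have : Continuous fun x => if x ≤ 1 / 2 then branch α t x else 2 - branch α t (1 - x) := by
      have hb := continuous_branch (t := t) hα
      refine Continuous.if_le hb (by fun_prop) continuous_id continuous_const ?_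
      rintro x rfl
      rw [show (1 : ℝ) - 1 / 2 = 1 / 2 by norm_num, branch_half hα]
      norm_num
    refine this.continuousOn.congr fun x hx => ?_
    dsimp only
    split_ifs with h
    · exact Flift_eq_branch hα hx.1 h
    · rw [← Flift_one_sub hα (by linarith [hx.2]) (by linarith), sub_sub_cancel]
  refine AddCircle.liftIco_zero_continuous ?_ ?_
  · have h0 := Flift_eq_branch (t := t) hα le_rfl (by norm_num : (0 : ℝ) ≤ 1 / 2)
    have h1 := Flift_one_sub (t := t) hα le_rfl (by norm_num : (0 : ℝ) ≤ 1 / 2)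
    rw [sub_zero] at h1
    rw [h0, h1, branch_zero hα, sub_zero, coe_two_eq_zero, AddCircle.coe_zero]
  · exact (AddCircle.continuous_mk' 1).comp_continuousOn hc

lemma continuous_fmap_param {α : ℝ} (hα : 0 < α) (z : Circle1) :
    Continuous fun t => fmap α t z := by
  obtain ⟨x, h0, h1, rfl | rfl⟩ := exists_half_rep z
  · simp_rw [fmap_coe hα h0 h1]
    exact (AddCircle.continuous_mk' 1).comp continuous_branch_param
  · simp_rw [fmap_neg_coe hα h0 h1]
    exact ((AddCircle.continuous_mk' 1).comp continuous_branch_param).neg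

lemma eventually_lt_volume_inter {A : Set ℝ} {x c : ℝ}
    (hA : Tendsto (fun r => volume (A ∩ Metric.closedBall x r) / volume (Metric.closedBall x r))
      (𝓝[>] 0) (𝓝 1)) (hc : c < 1) :
    ∀ᶠ r in 𝓝[>] (0 : ℝ), ENNReal.ofReal (c * (2 * r)) ≤
      volume (A ∩ Metric.closedBall x r) := by
  have h1 : ENNReal.ofReal c < 1 := by simpa using hc
  filter_upwards [hA.eventually (lt_mem_nhds h1), self_mem_nhdsWithin] with r hr hr0
  have hr0 : 0 < r := hr0
  rw [Real.volume_closedBall, ENNReal.lt_div_iff_mul_lt (Or.inl (by simpa using hr0))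
    (Or.inl ENNReal.ofReal_ne_top)] at hr
  rw [ENNReal.ofReal_mul' (by positivity)]
  exact hr.le

lemma volume_le_mul_volume_image {f : ℝ → ℝ} {s : Set ℝ} {l : ℝ} (hl : 0 < l)
    (hf : ∀ x ∈ s, ∀ y ∈ s, l * |x - y| ≤ |f x - f y|) :
    volume s ≤ ENNReal.ofReal l⁻¹ * volume (f '' s) := by
  have hinj : InjOn f s := fun x hx y hy h => by
    have := hf x hx y hy
    rw [h, sub_self, abs_zero] at this
    have h0 : |x - y| ≤ 0 := by
      by_contra! h'
      exact absurd this (not_le.2 (mul_pos hl h'))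
    exact sub_eq_zero.1 (abs_nonpos_iff.1 h0)
  have hL : LipschitzOnWith l⁻¹.toNNReal (Function.invFunOn f s) (f '' s) := by
    refine LipschitzOnWith.of_dist_le_mul ?_
    rintro _ ⟨x, hx, rfl⟩ _ ⟨y, hy, rfl⟩
    rw [hinj.leftInvOn_invFunOn hx, hinj.leftInvOn_invFunOn hy, Real.dist_eq, Real.dist_eq,
      Real.coe_toNNReal _ (inv_nonneg.2 hl.le), inv_mul_eq_div, le_div_iff₀ hl, mul_comm]
    exact hf x hx y hy
  have := hL.hausdorffMeasure_image_le zero_le_one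
  rw [hausdorffMeasure_real, hinj.invFunOn_image Subset.rfl] at this
  simpa [ENNReal.ofReal] using this

/-- A nonlinear Steinhaus theorem: if `x` is a density point of `A`, `Ψ (y, x)` is a density point
of `S` and `Ψ` is strictly differentiable at `(y, x)` with nonzero second partial derivative, then
for all `y'` close to `y` some `Ψ (y', ·)` maps a point of `A` into `S`. -/
lemma eventually_exists_mem_of_density {A S : Set ℝ} {Ψ : ℝ × ℝ → ℝ} {Ψ' : ℝ × ℝ →L[ℝ] ℝ}
    {x y : ℝ} (hS : MeasurableSet S) (hΨ : HasStrictFDerivAt Ψ Ψ' (y, x)) (hΨ' : Ψ' (0, 1) ≠ 0)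
    (hA : Tendsto (fun r => volume (A ∩ Metric.closedBall x r) / volume (Metric.closedBall x r))
      (𝓝[>] 0) (𝓝 1))
    (hSd : Tendsto (fun r => volume (S ∩ Metric.closedBall (Ψ (y, x)) r) /
      volume (Metric.closedBall (Ψ (y, x)) r)) (𝓝[>] 0) (𝓝 1)) :
    ∀ᶠ y' in 𝓝 y, ∃ x' ∈ A, Ψ (y', x') ∈ S := by
  set κ := |Ψ' (0, 1)| with hκ
  have hκ0 : 0 < κ := abs_pos.2 hΨ'
  set l := κ / 2 with hl
  have hl0 : 0 < l := half_pos hκ0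
  set M := ‖Ψ'‖ + l with hM
  have hM0 : 0 < M := by positivity
  have hlM : l ≤ M := by linarith [norm_nonneg Ψ']
  have hloc := (Asymptotics.isLittleO_iff.1 hΨ.isLittleO) hl0
  rw [nhds_prod_eq, eventually_prod_self_iff'] at hloc
  obtain ⟨U, hU, hloc⟩ := hloc
  obtain ⟨ρ, hρ, hball⟩ := Metric.mem_nhds_iff.1 hU
  have hmem : ∀ y' x', |y' - y| < ρ → |x' - x| < ρ → (y', x') ∈ U := fun y' x' h1 h2 =>
    hball (by rw [Metric.mem_ball, Prod.dist_eq]; exact max_lt h1 h2)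
  set η := l / (8 * M) with hη
  have hη0 : 0 < η := by positivity
  have hmul : Tendsto (fun r : ℝ => 2 * M * r) (𝓝[>] (0 : ℝ)) (𝓝[>] (0 : ℝ)) := by
    refine tendsto_nhdsWithin_iff.2 ⟨?_, ?_⟩
    · have : Tendsto (fun r : ℝ => 2 * M * r) (𝓝 0) (𝓝 (2 * M * 0)) :=
        Continuous.tendsto (by fun_prop) 0
      rw [mul_zero] at this
      exact this.mono_left nhdsWithin_le_nhds
    · filter_upwards [self_mem_nhdsWithin] with r hr
      exact mem_Ioi.2 (mul_pos (by positivity) (mem_Ioi.1 hr))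
  have hpos : ∀ᶠ r in 𝓝[>] (0 : ℝ), 0 < r := self_mem_nhdsWithin
  have hsmall : ∀ᶠ r in 𝓝[>] (0 : ℝ), r < ρ := nhdsWithin_le_nhds (gt_mem_nhds hρ)
  obtain ⟨r, hrA, hrS, hr0, hrρ⟩ :=
    ((eventually_lt_volume_inter hA (by norm_num : (1 / 2 : ℝ) < 1)).and
      ((hmul.eventually (eventually_lt_volume_inter hSd (by linarith : 1 - η < 1))).and
        (hpos.and hsmall))).exists
  filter_upwards [Metric.closedBall_mem_nhds y hr0] with y' hy'
  have hy' : |y' - y| ≤ r := hy'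
  by_contra! hno
  set J := A ∩ Metric.closedBall x r
  have hJ : ∀ x' ∈ J, |x' - x| ≤ r := fun x' hx' => hx'.2
  set I := Metric.closedBall (Ψ (y, x)) (2 * M * r)
  have hlow : ∀ u ∈ J, ∀ v ∈ J, l * |u - v| ≤ |Ψ (y', u) - Ψ (y', v)| := fun u hu v hv => by
    have h := hloc (y', u) (hmem _ _ (hy'.trans_lt hrρ) ((hJ u hu).trans_lt hrρ))
      (y', v) (hmem _ _ (hy'.trans_lt hrρ) ((hJ v hv).trans_lt hrρ))
    have hd : ((y', u) - (y', v) : ℝ × ℝ) = (u - v) • ((0 : ℝ), (1 : ℝ)) := by simp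
    have hn : ‖((0 : ℝ), (1 : ℝ))‖ = 1 := by simp [Prod.norm_def]
    simp only [hd, map_smul, norm_smul, hn, smul_eq_mul, Real.norm_eq_abs, mul_one] at h
    have h2 : |(u - v) * Ψ' (0, 1)| = |u - v| * κ := abs_mul _ _
    have h3 := abs_sub_abs_le_abs_sub ((u - v) * Ψ' (0, 1)) (Ψ (y', u) - Ψ (y', v))
    rw [abs_sub_comm] at h
    rw [h2] at h3
    have : κ = 2 * l := by rw [hl]; ring
    rw [this] at h3
    linarith
  have hup : ∀ u ∈ J, Ψ (y', u) ∈ I := fun u hu => by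
    have h := hloc (y', u) (hmem _ _ (hy'.trans_lt hrρ) ((hJ u hu).trans_lt hrρ))
      (y, x) (hmem _ _ (by simpa using hρ) (by simpa using hρ))
    have hd : ‖((y', u) - (y, x) : ℝ × ℝ)‖ ≤ r := by
      rw [Prod.norm_def]
      exact max_le hy' (hJ u hu)
    have h2 := Ψ'.le_opNorm ((y', u) - (y, x))
    have h3 := norm_sub_norm_le (Ψ (y', u) - Ψ (y, x)) (Ψ' ((y', u) - (y, x)))
    have h4 : M * ‖((y', u) - (y, x) : ℝ × ℝ)‖ ≤ M * r := mul_le_mul_of_nonneg_left hd hM0.le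
    have h5 : 0 ≤ M * r := by positivity
    rw [Metric.mem_closedBall, dist_eq_norm]
    rw [hM] at h4 h5 ⊢
    linarith
  have hsub : (fun u => Ψ (y', u)) '' J ⊆ I \ (S ∩ I) := by
    rintro _ ⟨u, hu, rfl⟩
    exact ⟨hup u hu, fun h => hno u hu.1 h.1⟩
  have hI : volume (I \ (S ∩ I)) ≤ ENNReal.ofReal (η * (2 * (2 * M * r))) := by
    rw [measure_sdiff inter_subset_right (hS.inter measurableSet_closedBall).nullMeasurableSet
      (ne_top_of_le_ne_top measure_closedBall_lt_top.ne (measure_mono inter_subset_right))]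
    refine (tsub_le_tsub_left hrS _).trans ?_
    rw [Real.volume_closedBall, ← ENNReal.ofReal_sub _ ?_]
    · exact ENNReal.ofReal_le_ofReal (by linarith)
    · have : η ≤ 1 := by rw [hη, div_le_one (by positivity)]; linarith
      have : 0 ≤ 1 - η := by linarith
      positivity
  have hfin := (hrA.trans (volume_le_mul_volume_image hl0 hlow)).trans
    (mul_le_mul_right ((measure_mono hsub).trans hI) _)
  rw [← ENNReal.ofReal_mul (by positivity), ENNReal.ofReal_le_ofReal_iff (by positivity)] at hfin
  have : l⁻¹ * (η * (2 * (2 * M * r))) = r / 2 := by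
    rw [hη]
    field_simp
    norm_num
  linarith
/-- The equation `f_t(x) = y` can be solved for the parameter `t = Ψ (y, x)`, with `Ψ` strictly
differentiable and `∂Ψ/∂x ≠ 0`. -/
lemma exists_param_hasStrictFDerivAt {α t x : ℝ} (hα : 0 < α) (ht0 : 0 < t) (ht1 : t ≤ 1)
    (hx0 : 0 < x) (hx1 : x < 1 / 2) :
    ∃ (Ψ : ℝ × ℝ → ℝ) (Ψ' : ℝ × ℝ →L[ℝ] ℝ), HasStrictFDerivAt Ψ Ψ' (branch α t x, x) ∧
      Ψ' (0, 1) ≠ 0 ∧ Ψ (branch α t x, x) = t ∧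
      ∀ y x', 0 < x' → x' < 1 / 2 → branch α (Ψ (y, x')) x' = y := by
  set d : ℝ → ℝ := fun x => x - 2 ^ α * x ^ (1 + α) with hd
  set c : ℝ → ℝ := fun x => 2 * (2 ^ α * x ^ (1 + α)) with hc
  have hb : ∀ t x, branch α t x = c x + t * d x := fun t x => by
    simp only [branch, hc, hd]
    ring
  have hd0 : ∀ x, 0 < x → x < 1 / 2 → 0 < d x := fun x h0 h1 => by
    have h2 : (2 * x) ^ α < 1 := Real.rpow_lt_one (by linarith) (by linarith) hα
    have h3 : d x = x * (1 - (2 * x) ^ α) := by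
      simp only [hd]
      rw [Real.rpow_one_add' h0.le (by linarith), Real.mul_rpow (by norm_num) h0.le]
      ring
    rw [h3]
    exact mul_pos h0 (by linarith)
  have hdx := hd0 x hx0 hx1
  set Ψ : ℝ × ℝ → ℝ := fun q => (q.1 - c q.2) / d q.2 with hΨ
  have hpow : ContDiffAt ℝ 1 (fun q : ℝ × ℝ => q.2 ^ (1 + α)) (branch α t x, x) :=
    contDiffAt_snd.rpow_const_of_ne hx0.ne'
  have hsmooth : ContDiffAt ℝ 1 Ψ (branch α t x, x) := by
    refine ContDiffAt.div (contDiffAt_fst.sub ?_) (contDiffAt_snd.sub ?_) hdx.ne'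
    · exact contDiffAt_const.mul (contDiffAt_const.mul hpow)
    · exact contDiffAt_const.mul hpow
  have hstrict := hsmooth.hasStrictFDerivAt one_ne_zero
  refine ⟨Ψ, _, hstrict, ?_, ?_, ?_⟩
  · intro h0
    have hline : HasDerivAt (fun u : ℝ => (branch α t x, u)) ((0 : ℝ), (1 : ℝ)) x :=
      (hasDerivAt_const x _).prodMk (hasDerivAt_id x)
    have h1 := hstrict.hasFDerivAt.comp_hasDerivAt x hline
    rw [h0] at h1
    have hder : HasDerivAt (fun u => branch α t x - c u - Ψ (branch α t x, u) * d u) 0 x := by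
      refine (hasDerivAt_const x (0 : ℝ)).congr_of_eventuallyEq ?_
      filter_upwards [Ioo_mem_nhds hx0 hx1] with u hu
      have := (hd0 u hu.1 hu.2).ne'
      simp only [hΨ]
      field_simp
      ring
    have hp : HasDerivAt (fun u : ℝ => u ^ (1 + α)) ((1 + α) * x ^ α) x := by
      have := Real.hasDerivAt_rpow_const (x := x) (p := 1 + α) (Or.inl hx0.ne')
      rwa [add_sub_cancel_left] at this
    have hc' : HasDerivAt c (2 * (2 ^ α * ((1 + α) * x ^ α))) x :=
      (hp.const_mul _).const_mul _
    have hd' : HasDerivAt d (1 - 2 ^ α * ((1 + α) * x ^ α)) x :=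
      (hasDerivAt_id x).sub (hp.const_mul _)
    have h2 := (hc'.const_sub (branch α t x)).sub (h1.mul hd')
    have h3 := hder.unique h2
    have hval : Ψ (branch α t x, x) = t := by
      simp only [hΨ, hb]
      field_simp
      ring
    simp only [Function.comp_apply, hval] at h3
    have h4 : 0 < (2 : ℝ) ^ α * ((1 + α) * x ^ α) := by positivity
    nlinarith
  · simp only [hΨ, hb]
    field_simp
    ring
  · intro y x' h0 h1
    have := (hd0 x' h0 h1).ne'
    rw [hb]
    simp only [hΨ]
    field_simp
    ring

/-- A closed symmetric periodic set of reals avoiding the hole `(-p, p)` and forward invariant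
under a positive measure set of expanding maps is empty. -/
lemma eq_empty_of_forward_invariant {α p lam : ℝ} {S D : Set ℝ} (hα : 0 < α) (hp : 0 < p)
    (hlam : 1 < lam) (hS : MeasurableSet S) (hSpos : volume S ≠ 0)
    (hS01 : ∀ t ∈ S, 0 < t ∧ t ≤ 1)
    (hexp : ∀ t ∈ S, ∀ x y, p ≤ x → x ≤ y → lam * (y - x) ≤ branch α t y - branch α t x)
    (hD : IsClosed D) (hrefl : ∀ x ∈ D, 1 - x ∈ D)
    (hhole : ∀ x ∈ D, 0 ≤ x → p ≤ x)
    (hinv : ∀ t ∈ S, ∀ x ∈ D, 0 ≤ x → x ≤ 1 / 2 → branch α t x ∈ D) :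
    D ∩ Icc 0 1 = ∅ := by
  by_contra hne
  obtain ⟨z, hzD, hz⟩ := nonempty_iff_ne_empty.2 hne
  obtain ⟨t₁, ht₁⟩ : S.Nonempty := nonempty_iff_ne_empty.2 fun h => hSpos (by simp [h])
  have h1D : (1 : ℝ) ∉ D := fun h => by
    have := hhole (1 - 1) (hrefl 1 h) (by norm_num)
    linarith
  have hhalf : ∀ x ∈ D, x ≠ 1 / 2 := by
    rintro x hx rfl
    have := hinv t₁ ht₁ _ hx (by norm_num) le_rfl
    rw [branch_half hα] at this
    exact h1D this
  have hb01 : ∀ t ∈ S, ∀ x, 0 ≤ x → x ≤ 1 / 2 → branch α t x ∈ Icc (0 : ℝ) 1 :=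
    fun t ht x h0 h1 => ⟨branch_nonneg hα (hS01 t ht).1.le (hS01 t ht).2 h0,
      branch_le_one hα (hS01 t ht).2 h0 h1⟩
  -- points of `D` in the left half
  obtain ⟨x₀, hx₀D, hx₀0, hx₀1⟩ : ∃ x ∈ D, 0 < x ∧ x < 1 / 2 := by
    rcases lt_or_gt_of_ne (hhalf z hzD) with h | h
    · exact ⟨z, hzD, hp.trans_le (hhole z hzD hz.1), h⟩
    · have h1 := hrefl z hzD
      exact ⟨1 - z, h1, hp.trans_le (hhole _ h1 (by linarith [hz.2])), by linarith⟩
  set A := D ∩ Ioo 0 (1 / 2) with hA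
  have hDpos : volume (D ∩ Icc 0 1) ≠ 0 := by
    have hslope : (x₀ - 2 ^ α * x₀ ^ (1 + α)) ≠ 0 := by
      have h2 : (2 * x₀) ^ α < 1 := Real.rpow_lt_one (by linarith) (by linarith) hα
      rw [Real.rpow_one_add' hx₀0.le (by linarith)]
      rw [Real.mul_rpow (by norm_num) hx₀0.le] at h2
      nlinarith
    have hpre : S ⊆ (fun t => (x₀ - 2 ^ α * x₀ ^ (1 + α)) * t) ⁻¹'
        ((fun s => s + 2 * (2 ^ α * x₀ ^ (1 + α))) ⁻¹' (D ∩ Icc 0 1)) := fun t ht => by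
      have h1 : branch α t x₀ = (x₀ - 2 ^ α * x₀ ^ (1 + α)) * t + 2 * (2 ^ α * x₀ ^ (1 + α)) := by
        rw [branch]; ring
      show (x₀ - 2 ^ α * x₀ ^ (1 + α)) * t + 2 * (2 ^ α * x₀ ^ (1 + α)) ∈ D ∩ Icc 0 1
      rw [← h1]
      exact ⟨hinv t ht x₀ hx₀D hx₀0.le hx₀1.le, hb01 t ht x₀ hx₀0.le hx₀1.le⟩
    intro h0
    refine hSpos (measure_mono_null hpre ?_)
    rw [Real.volume_preimage_mul_left hslope, measure_preimage_add_right, h0, mul_zero]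
  have hApos : volume A ≠ 0 := by
    intro h0
    refine hDpos (measure_mono_null (t := A ∪ (fun x => 1 - x) ⁻¹' A) ?_ ?_)
    · rintro x ⟨hxD, hx⟩
      rcases lt_or_gt_of_ne (hhalf x hxD) with h | h
      · exact Or.inl ⟨hxD, hp.trans_le (hhole x hxD hx.1), h⟩
      · have h1 := hrefl x hxD
        exact Or.inr ⟨h1, hp.trans_le (hhole _ h1 (by linarith [hx.2])), by linarith⟩
    · refine measure_union_null h0 ?_
      rw [(Measure.measurePreserving_sub_left volume (1 : ℝ)).measure_preimage
        (hD.measurableSet.inter measurableSet_Ioo).nullMeasurableSet, h0]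
  have hdens : ∀ B : Set ℝ, MeasurableSet B → volume B ≠ 0 → ∃ x ∈ B,
      Tendsto (fun r => volume (B ∩ Metric.closedBall x r) / volume (Metric.closedBall x r))
        (𝓝[>] 0) (𝓝 1) := fun B hB hB0 => by
    have h1 := Besicovitch.ae_tendsto_measure_inter_div volume B
    have : NeBot (ae (volume.restrict B)) := ae_neBot.2 (by simpa using hB0)
    obtain ⟨x, hx, hxB⟩ := (h1.and (ae_restrict_mem hB)).exists
    exact ⟨x, hxB, hx⟩
  obtain ⟨x, ⟨hxD, hx0, hx1⟩, hxA⟩ := hdens A (hD.measurableSet.inter measurableSet_Ioo) hApos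
  obtain ⟨t, htS, ht⟩ := hdens S hS hSpos
  obtain ⟨Ψ, Ψ', hΨ, hΨ', hΨt, hbr⟩ :=
    exists_param_hasStrictFDerivAt hα (hS01 t htS).1 (hS01 t htS).2 hx0 hx1
  have hev := eventually_exists_mem_of_density hS hΨ hΨ' hxA (by rwa [hΨt])
  have hint : ∀ᶠ y in 𝓝 (branch α t x), y ∈ D ∩ Icc 0 1 := by
    filter_upwards [hev] with y hy
    obtain ⟨x', ⟨hx'D, hx'0, hx'1⟩, hx'S⟩ := hy
    rw [← hbr y x' hx'0 hx'1]
    exact ⟨hinv _ hx'S x' hx'D hx'0.le hx'1.le, hb01 _ hx'S x' hx'0.le hx'1.le⟩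
  obtain ⟨δ, hδ, hball⟩ := Metric.nhds_basis_closedBall.mem_iff.1 hint
  rw [Real.closedBall_eq_Icc] at hball
  -- intervals contained in `D` can be made arbitrarily long
  have hgrow : ∀ n : ℕ, ∃ u v, u ≤ v ∧ lam ^ n * δ ≤ v - u ∧ Icc u v ⊆ D ∩ Icc 0 1 := by
    intro n
    induction n with
    | zero => exact ⟨_, _, by linarith, by linarith, hball⟩
    | succ n ih =>
      obtain ⟨u, v, huv, hlen, hsub⟩ := ih
      obtain ⟨u', v', huv', hlen', hv', hsub'⟩ : ∃ u' v', u' ≤ v' ∧ v' - u' = v - u ∧ v' ≤ 1 / 2 ∧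
          Icc u' v' ⊆ D ∩ Icc 0 1 := by
        rcases le_total v (1 / 2) with h | h
        · exact ⟨u, v, huv, rfl, h, hsub⟩
        · have hu : 1 / 2 ≤ u := by
            by_contra! h'
            exact hhalf _ (hsub ⟨h'.le, h⟩).1 rfl
          refine ⟨1 - v, 1 - u, by linarith, by ring, by linarith, fun y hy => ?_⟩
          have hy' := hsub (show 1 - y ∈ Icc u v from ⟨by linarith [hy.2], by linarith [hy.1]⟩)
          have := hrefl _ hy'.1
          rw [sub_sub_cancel] at this
          exact ⟨this, by linarith [hy'.2.2], by linarith [hy'.2.1]⟩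
      have hu' := hsub' ⟨le_rfl, huv'⟩
      have hpu : p ≤ u' := hhole u' hu'.1 hu'.2.1
      have hstep := hexp t htS u' v' hpu huv'
      refine ⟨branch α t u', branch α t v', by nlinarith, ?_, ?_⟩
      · rw [pow_succ']
        nlinarith
      · intro y hy
        obtain ⟨w, hw, rfl⟩ := intermediate_value_Icc huv' (continuous_branch hα).continuousOn hy
        have hw' := hsub' hw
        exact ⟨hinv t htS w hw'.1 hw'.2.1 (hw.2.trans hv'),
          hb01 t htS w hw'.2.1 (hw.2.trans hv')⟩
  obtain ⟨n, hn⟩ := pow_unbounded_of_one_lt (1 / δ) hlam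
  rw [div_lt_iff₀ hδ] at hn
  obtain ⟨u, v, huv, hlen, hsub⟩ := hgrow n
  linarith [(hsub (left_mem_Icc.2 huv)).2.1, (hsub (right_mem_Icc.2 huv)).2.2]

lemma eq_zero_of_mem_support {X : Type*} [TopologicalSpace X] [MeasurableSpace X]
    {ν : Measure X} {g : X → ℝ} (hg : Continuous g)
    (h0 : 0 ≤ᵐ[ν] g) (hi : Integrable g ν) (hz : ∫ x, g x ∂ν = 0) {x : X} (hx : x ∈ ν.support) :
    g x = 0 := by
  by_contra hne
  have hae : ν {y | g y ≠ 0} = 0 := (integral_eq_zero_iff_of_nonneg_ae h0 hi).1 hz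
  have hnhds : {y | g y ≠ 0} ∈ 𝓝 x := (isOpen_ne_fun hg continuous_const).mem_nhds hne
  exact ((Measure.mem_support_iff_forall x).1 hx _ hnhds).ne' hae

/-- A bounded separately continuous function with vanishing iterated integral which is nonnegative
on the product of the supports vanishes there. -/
lemma eq_zero_of_iterated_integral_eq_zero {X Y : Type*}
    [TopologicalSpace X] [MeasurableSpace X] [BorelSpace X] [FirstCountableTopology X]
    [HereditarilyLindelofSpace X]
    [TopologicalSpace Y] [MeasurableSpace Y] [BorelSpace Y] [HereditarilyLindelofSpace Y]
    {μ : Measure X} {θ : Measure Y} [IsFiniteMeasure μ] [IsFiniteMeasure θ] {G : X → Y → ℝ} {C : ℝ}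
    (hX : ∀ y, Continuous fun x => G x y) (hY : ∀ x, Continuous (G x)) (hC : ∀ x y, |G x y| ≤ C)
    (h0 : ∀ x, ∀ y ∈ θ.support, 0 ≤ G x y) (hz : ∫ x, ∫ y, G x y ∂θ ∂μ = 0) :
    ∀ x ∈ μ.support, ∀ y ∈ θ.support, G x y = 0 := by
  have hint : ∀ x, Integrable (G x) θ := fun x =>
    Integrable.of_bound (hY x).measurable.aestronglyMeasurable C (.of_forall (hC x))
  have hae : ∀ x, 0 ≤ᵐ[θ] G x := fun x => by
    filter_upwards [Measure.support_mem_ae (μ := θ)] with y hy using h0 x y hy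
  have hcont : Continuous fun x => ∫ y, G x y ∂θ :=
    continuous_of_dominated (bound := fun _ => C)
      (fun x => (hY x).measurable.aestronglyMeasurable)
      (fun x => .of_forall (hC x)) (integrable_const C) (.of_forall hX)
  have hnn : ∀ x, 0 ≤ ∫ y, G x y ∂θ := fun x => integral_nonneg_of_ae (hae x)
  have hI : Integrable (fun x => ∫ y, G x y ∂θ) μ :=
    Integrable.of_bound hcont.measurable.aestronglyMeasurable (C * θ.real univ)
      (.of_forall fun x => norm_integral_le_of_norm_le_const (.of_forall (hC x)))
  intro x hx y hy
  exact eq_zero_of_mem_support (hY x) (hae x) (hint x)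
    (eq_zero_of_mem_support hcont (.of_forall hnn) hI hz hx) hy

lemma eq_dirac_of_support_subset {X : Type*} [TopologicalSpace X] [MeasurableSpace X]
    [HereditarilyLindelofSpace X]
    [MeasurableSingletonClass X] {μ : Measure X} [IsProbabilityMeasure μ] {x : X}
    (h : μ.support ⊆ {x}) : μ = Measure.dirac x := by
  have h1 : μ {x}ᶜ = 0 :=
    measure_mono_null (compl_subset_compl.2 h) Measure.measure_compl_support
  have h2 : μ {x} = 1 := (prob_compl_eq_zero_iff (measurableSet_singleton x)).1 h1
  have h3 : μ = μ.restrict {x} := (Measure.restrict_eq_self_of_ae_mem (mem_ae_iff.2 h1)).symm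
  rw [h3, Measure.restrict_singleton, h2, one_smul]

lemma support_eq_mSupport {Y : Type*} [TopologicalSpace Y] [MeasurableSpace Y] (θ : Measure Y) :
    θ.support = mSupport θ := by
  ext t
  simp [Measure.mem_support_iff_forall, mSupport, pos_iff_ne_zero]

lemma norm_coe_eq_self {x : ℝ} (h0 : 0 ≤ x) (h1 : x ≤ 1 / 2) : ‖(x : Circle1)‖ = x := by
  rw [(AddCircle.norm_coe_eq_abs_iff (1 : ℝ) one_ne_zero).2, abs_of_nonneg h0]
  rwa [abs_of_nonneg h0, abs_one]

/-- The truncated distance to `0` decreases along every `f_t`, strictly in the hole. -/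
lemma min_norm_fmap_le {α t b p : ℝ} (hα : 0 < α) (hb : b < 1) (ht0 : 0 ≤ t) (htb : t ≤ b)
    (hp1 : p ≤ 1 / 2)
    (hp : (2 * p) ^ α = (1 - b) / (2 - b)) (z : Circle1) :
    min ‖fmap α t z‖ p ≤ min ‖z‖ p ∧
      (z ≠ 0 → ‖z‖ < p → min ‖fmap α t z‖ p < min ‖z‖ p) := by
  obtain ⟨x, h0, h1, hz⟩ := exists_half_rep z
  have hn : ‖z‖ = x := by
    rcases hz with rfl | rfl
    · exact norm_coe_eq_self h0 h1
    · rw [norm_neg, norm_coe_eq_self h0 h1]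
  have hfn : ‖fmap α t z‖ = ‖(branch α t x : Circle1)‖ := by
    rcases hz with rfl | rfl
    · rw [fmap_coe hα h0 h1]
    · rw [fmap_neg_coe hα h0 h1, norm_neg]
  have hstrict : z ≠ 0 → ‖z‖ < p → min ‖fmap α t z‖ p < min ‖z‖ p := fun hz0 hzp => by
    have hx0 : 0 < x := hn ▸ norm_pos_iff.2 hz0
    have hlt := branch_lt_self hα hb htb hp hx0 (hn ▸ hzp)
    rw [hfn, min_eq_left hzp.le, hn,
      norm_coe_eq_self (branch_nonneg hα ht0 (by linarith) h0) (by linarith)]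
    exact (min_le_left _ _).trans_lt hlt
  refine ⟨?_, hstrict⟩
  rcases eq_or_ne z 0 with rfl | hz0
  · rw [fmap_zero hα]
  · rcases lt_or_ge ‖z‖ p with h | h
    · exact (hstrict hz0 h).le
    · rw [min_eq_right h]
      exact min_le_right _ _

/-- A closed subset of the circle, away from `0`, which is forward invariant under a positive
measure set of expanding maps is empty. -/
lemma circle_eq_empty_of_forward_invariant {α p lam : ℝ} {S : Set ℝ} {K : Set Circle1}
    (hα : 0 < α) (hp : 0 < p) (hlam : 1 < lam) (hS : MeasurableSet S) (hSpos : volume S ≠ 0)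
    (hS01 : ∀ t ∈ S, 0 < t ∧ t ≤ 1)
    (hexp : ∀ t ∈ S, ∀ x y, p ≤ x → x ≤ y → lam * (y - x) ≤ branch α t y - branch α t x)
    (hK : IsClosed K) (hhole : ∀ z ∈ K, p ≤ ‖z‖) (hinv : ∀ t ∈ S, ∀ z ∈ K, fmap α t z ∈ K) :
    K = ∅ := by
  set D : Set ℝ := {x | (x : Circle1) ∈ K ∨ -(x : Circle1) ∈ K} with hDdef
  have hcoe : Continuous ((↑) : ℝ → Circle1) := AddCircle.continuous_mk' 1
  have hD : IsClosed D := (hK.preimage hcoe).union (hK.preimage hcoe.neg)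
  have hrefl : ∀ x ∈ D, 1 - x ∈ D := fun x hx => by
    have h : ((1 - x : ℝ) : Circle1) = -(x : Circle1) := by
      rw [AddCircle.coe_sub, AddCircle.coe_period, zero_sub]
    simp only [hDdef, mem_ofPred_eq, h, neg_neg]
    exact hx.symm
  have hDhole : ∀ x ∈ D, 0 ≤ x → p ≤ x := fun x hx h0 => by
    have h1 : p ≤ ‖(x : Circle1)‖ := by
      rcases hx with h | h
      · exact hhole _ h
      · simpa using hhole _ h
    have h2 : ‖(x : Circle1)‖ ≤ ‖x‖ := QuotientAddGroup.norm_mk_le_norm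
    rw [Real.norm_of_nonneg h0] at h2
    exact h1.trans h2
  have hDinv : ∀ t ∈ S, ∀ x ∈ D, 0 ≤ x → x ≤ 1 / 2 → branch α t x ∈ D :=
    fun t ht x hx h0 h1 => hx.imp (fun h => fmap_coe hα h0 h1 ▸ hinv t ht _ h)
      (fun h => fmap_neg_coe hα h0 h1 ▸ hinv t ht _ h)
  have hempty :=
    eq_empty_of_forward_invariant hα hp hlam hS hSpos hS01 hexp hD hrefl hDhole hDinv
  refine eq_empty_iff_forall_notMem.2 fun z hz => ?_
  obtain ⟨x, h0, h1, hzx⟩ := exists_half_rep z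
  refine eq_empty_iff_forall_notMem.1 hempty x ⟨?_, h0, by linarith⟩
  rcases hzx with rfl | rfl
  · exact Or.inl hz
  · exact Or.inr hz

/-- Any stationary measure is the Dirac mass at `0` when the noise takes values in `[a, b]`, the
point `p` is the repelling fixed point of `f_b`, and all maps expand outside the hole `(-p, p)`. -/
lemma eq_dirac_of_isStationaryC {α a b p lam : ℝ} (hα : 0 < α) (ha : 0 < a) (hb : b < 1)
    (hp : 0 < p) (hp1 : p ≤ 1 / 2) (hpb : (2 * p) ^ α = (1 - b) / (2 - b)) (hlam : 1 < lam)
    (hexp : ∀ t ∈ Icc a b, ∀ x y, p ≤ x → x ≤ y →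
      lam * (y - x) ≤ branch α t y - branch α t x)
    {θ : Measure ℝ} [IsProbabilityMeasure θ] (hθ : θ ≪ volume) (hsupp : θ.support ⊆ Icc a b)
    {μ : Measure Circle1} [IsProbabilityMeasure μ] (hμ : IsStationaryC (fmap α) θ μ) :
    μ = Measure.dirac 0 := by
  have hθpos : volume θ.support ≠ 0 := fun h => by
    have h1 := hθ h
    have h2 : θ univ = 0 := by
      rw [← union_compl_self θ.support]
      exact measure_union_null h1 Measure.measure_compl_support
    simp at h2
  have hinv : ∀ x ∈ μ.support, ∀ t ∈ θ.support, fmap α t x ∈ μ.support := by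
    intro x hx t ht
    set φ : C(Circle1, ℝ) := ⟨fun z => Metric.infDist z μ.support, Metric.continuous_infDist_pt _⟩
    have h0 : ∫ z, φ z ∂μ = 0 := integral_eq_zero_of_ae <| by
      filter_upwards [Measure.support_mem_ae (μ := μ)] with z hz
      exact Metric.infDist_zero_of_mem hz
    have h1 := eq_zero_of_iterated_integral_eq_zero (G := fun z s => φ (fmap α s z)) (C := ‖φ‖)
      (fun s => φ.continuous.comp (continuous_fmap hα))
      (fun z => φ.continuous.comp (continuous_fmap_param hα z))
      (fun z s => φ.norm_coe_le_norm _) (fun z s _ => Metric.infDist_nonneg)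
      ((hμ φ).trans h0) x hx t ht
    exact (Measure.isClosed_support.mem_iff_infDist_zero ⟨x, hx⟩).2 h1
  have hlyap : ∀ x ∈ μ.support, ∀ t ∈ θ.support, min ‖fmap α t x‖ p = min ‖x‖ p := by
    intro x hx t ht
    set φ : C(Circle1, ℝ) := ⟨fun z => min ‖z‖ p, by fun_prop⟩ with hφ
    have hbd : ∀ z s, |φ z - φ (fmap α s z)| ≤ ‖φ‖ + ‖φ‖ := fun z s =>
      (abs_sub _ _).trans (add_le_add (φ.norm_coe_le_norm _) (φ.norm_coe_le_norm _))
    have hi : ∀ z, Integrable (fun s => φ (fmap α s z)) θ := fun z =>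
      Integrable.of_bound
        (φ.continuous.comp (continuous_fmap_param hα z)).measurable.aestronglyMeasurable ‖φ‖
        (.of_forall fun s => φ.norm_coe_le_norm _)
    have hcont : Continuous fun z => ∫ s, φ (fmap α s z) ∂θ :=
      continuous_of_dominated (bound := fun _ => ‖φ‖) (fun z => (hi z).aestronglyMeasurable)
        (fun z => .of_forall fun s => φ.norm_coe_le_norm _) (integrable_const _)
        (.of_forall fun s => φ.continuous.comp (continuous_fmap hα))
    have hz : ∫ z, ∫ s, (φ z - φ (fmap α s z)) ∂θ ∂μ = 0 := by
      have h1 : ∀ z, ∫ s, (φ z - φ (fmap α s z)) ∂θ = φ z - ∫ s, φ (fmap α s z) ∂θ := fun z => by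
        rw [integral_sub (integrable_const _) (hi z)]
        simp
      simp_rw [h1]
      rw [integral_sub (φ.continuous.integrable_of_hasCompactSupport
          (HasCompactSupport.of_compactSpace _))
        (hcont.integrable_of_hasCompactSupport (HasCompactSupport.of_compactSpace _)),
        hμ φ, sub_self]
    have h1 := eq_zero_of_iterated_integral_eq_zero (G := fun z s => φ z - φ (fmap α s z))
      (fun s => φ.continuous.sub (φ.continuous.comp (continuous_fmap hα)))
      (fun z => continuous_const.sub (φ.continuous.comp (continuous_fmap_param hα z)))
      hbd (fun z s hs => sub_nonneg.2 (min_norm_fmap_le hα hb (ha.le.trans (hsupp hs).1)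
        (hsupp hs).2 hp1 hpb z).1) hz x hx t ht
    exact (sub_eq_zero.1 h1).symm
  obtain ⟨t₀, ht₀⟩ : θ.support.Nonempty := nonempty_iff_ne_empty.2 fun h => hθpos (by simp [h])
  have hdich : ∀ x ∈ μ.support, x ≠ 0 → p ≤ ‖x‖ := fun x hx hx0 => by
    by_contra! h
    exact ((min_norm_fmap_le hα hb (ha.le.trans (hsupp ht₀).1) (hsupp ht₀).2 hp1 hpb x).2 hx0
      h).ne (hlyap x hx t₀ ht₀)
  have hK : μ.support ∩ {z | p ≤ ‖z‖} = ∅ := by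
    refine circle_eq_empty_of_forward_invariant hα hp hlam Measure.isClosed_support.measurableSet
      hθpos (fun t ht => ⟨ha.trans_le (hsupp ht).1, ((hsupp ht).2.trans_lt hb).le⟩)
      (fun t ht => hexp t (hsupp ht))
      (Measure.isClosed_support.inter (isClosed_le continuous_const continuous_norm))
      (fun z hz => hz.2) (fun t ht z hz => ⟨hinv z hz.1 t ht, ?_⟩)
    exact min_eq_right_iff.1 ((hlyap z hz.1 t ht).trans (min_eq_right hz.2))
  refine eq_dirac_of_support_subset fun x hx => ?_
  by_contra hx0
  exact eq_empty_iff_forall_notMem.1 hK x ⟨hx, hdich x hx hx0⟩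

/-- for every sufficiently small `ε > 0` there are `1 - ε < a < b < 1`
such that for every absolutely continuous noise distribution supported in `[a,b]`,
the Dirac measure at `0` is the unique stationary probability measure of the
random system `((f_t)_t, θ)`. -/
theorem dirac_unique_stationary_measure
    (α : ℝ) (hα0 : 0 < α) (hα1 : α < 1) :
    ∃ ε₀ > (0 : ℝ), ∀ ε : ℝ, 0 < ε → ε < ε₀ →
      ∃ a b : ℝ, 1 - ε < a ∧ a < b ∧ b < 1 ∧
        ∀ θ : Measure ℝ, IsProbabilityMeasure θ → θ ≪ volume →
          mSupport θ ⊆ Icc a b →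
          IsStationaryC (fmap α) θ (Measure.dirac (0 : Circle1)) ∧
          ∀ μ : Measure Circle1, IsProbabilityMeasure μ →
            IsStationaryC (fmap α) θ μ → μ = Measure.dirac (0 : Circle1) := by
  refine ⟨1 / 2, by norm_num, fun ε hε hε1 => ?_⟩
  set u := ε / 2 with hu
  have hu0 : 0 < u := by positivity
  have hu1 : u < 1 / 4 := by linarith
  have hαu : 0 < α * u := mul_pos hα0 hu0
  have hαu1 : α * u < u := by nlinarith
  refine ⟨1 - (1 + α / 2) * u, 1 - u, by linarith, by linarith, by linarith, ?_⟩
  intro θ hθ hac hsupp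
  refine ⟨fun φ => ?_, fun μ hμ hstat => ?_⟩
  · rw [integral_dirac, integral_dirac]
    simp [fmap_zero hα0]
  · set q := u / (1 + u) with hq
    have hq0 : 0 < q := by positivity
    have hq1 : q ≤ 1 := by rw [hq, div_le_one (by linarith)]; linarith
    have hqu : q * (1 + u) = u := div_mul_cancel₀ _ (by linarith)
    have hpq : (2 * (1 / 2 * q ^ (1 / α))) ^ α = q := by
      rw [← mul_assoc, show (2 : ℝ) * (1 / 2) = 1 by norm_num, one_mul, ← Real.rpow_mul hq0.le,
        one_div_mul_cancel hα0.ne', Real.rpow_one]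
    have hp0 : 0 < 1 / 2 * q ^ (1 / α) := by positivity
    have hp1 : 1 / 2 * q ^ (1 / α) ≤ 1 / 2 := by
      have : q ^ (1 / α) ≤ 1 := Real.rpow_le_one hq0.le hq1 (by positivity)
      linarith
    refine eq_dirac_of_isStationaryC (a := 1 - (1 + α / 2) * u) (b := 1 - u)
      (lam := 1 + α / 2 * u) hα0 (by linarith) (by linarith) hp0 hp1 ?_ (by linarith) ?_ hac
      (support_eq_mSupport θ ▸ hsupp) hstat
    · rw [hpq, hq]
      congr 1 <;> ring
    · intro t ht x y hx hxy
      refine le_trans ?_ (branch_expanding hα0 (by linarith [ht.2]) hp0 hpq hx hxy)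
      refine mul_le_mul_of_nonneg_right ?_ (by linarith)
      have h1 : u ≤ (2 - t) * q := by
        rw [← hqu, mul_comm]
        exact mul_le_mul_of_nonneg_right (by linarith [ht.2]) hq0.le
      have h2 := mul_le_mul_of_nonneg_left h1 (by linarith : 0 ≤ 1 + α)
      linarith [ht.1]
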